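/- Let V be a real inner product space of dimension 2n with n ≥ 2, with inner product g and a linear isometry J : V → V satisfying J∘J = −id, and let R be an algebraic curvature tensor on V with constant antiholomorphic sectional curvature ν. Then for all X,Y ∈ V: ρ*(R + L₃R)(X,Y) = ρ*(R)(X,Y) + ρ*(R)(Y,X), and ρ*(R + L₃R)(JX,JY) = ρ*(R + L₃R)(X,Y). -/

import Mathlib

open scoped RealInnerProductSpace BigOperators

/-- The `*`-Ricci tensor: `ρ*(R)(X,Y) = Σ_i R(e_i, X, J e_i, J Y)`. -/
noncomputable def rhoStar {V : Type*} [NormedAddCommGroup V] [InnerProductSpace ℝ V]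
    {ι : Type*} [Fintype ι] (b : OrthonormalBasis ι ℝ V) (J : V →ₗ[ℝ] V)
    (R : V → V → V → V → ℝ) (X Y : V) : ℝ :=
  ∑ i, R (b i) X (J (b i)) (J Y)

/-- Skewness of `J` gives `Σ F(J e_i, e_i) = - Σ F(e_i, J e_i)` for a bilinear form `F`. -/
theorem sum_J_swap {V : Type*} [NormedAddCommGroup V] [InnerProductSpace ℝ V]
    {ι : Type*} [Fintype ι] (b : OrthonormalBasis ι ℝ V) (J : V →ₗ[ℝ] V)
    (hJ : ∀ X Y : V, ⟪X, J Y⟫ = -⟪Y, J X⟫)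
    (F : V →ₗ[ℝ] V →ₗ[ℝ] ℝ) :
    ∑ i, F (J (b i)) (b i) = - ∑ i, F (b i) (J (b i)) := by
  have h1 : ∀ i, F (J (b i)) (b i) = ∑ j, ⟪b j, J (b i)⟫ * F (b j) (b i) := by
    intro i
    conv_lhs => rw [← b.sum_repr' (J (b i))]
    simp only [map_sum, map_smul, LinearMap.sum_apply, LinearMap.smul_apply, smul_eq_mul]
  have h2 : ∀ i, F (b i) (J (b i)) = ∑ j, ⟪b j, J (b i)⟫ * F (b i) (b j) := by
    intro i
    conv_lhs => rw [← b.sum_repr' (J (b i))]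
    simp only [map_sum, map_smul, smul_eq_mul]
  simp only [h1, h2]
  rw [Finset.sum_comm, ← Finset.sum_neg_distrib]
  refine Finset.sum_congr rfl fun i _ => ?_
  rw [← Finset.sum_neg_distrib]
  refine Finset.sum_congr rfl fun j _ => ?_
  rw [hJ (b i) (b j)]
  ring

/-- if an algebraic curvature tensor `R` on a `2n`-dimensional
almost Hermitian inner product space (`n ≥ 2`) has constant antiholomorphic sectional
curvature `ν`, then `ρ*(R + L₃R)(X,Y) = ρ*(R)(X,Y) + ρ*(R)(Y,X)` and
`ρ*(R + L₃R)(JX,JY) = ρ*(R + L₃R)(X,Y)`, where `L₃R(X,Y,Z,W) = R(JX,JY,JZ,JW)`. -/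
theorem rhoStar_add_L3_symm
    {V : Type*} [NormedAddCommGroup V] [InnerProductSpace ℝ V]
    [FiniteDimensional ℝ V] (n : ℕ) (hn : 2 ≤ n)
    (hdim : Module.finrank ℝ V = 2 * n)
    (b : OrthonormalBasis (Fin (2 * n)) ℝ V)
    (J : V →ₗ[ℝ] V)
    (hJ2 : ∀ X : V, J (J X) = -X)
    (hJiso : ∀ X Y : V, ⟪J X, J Y⟫ = ⟪X, Y⟫)
    (R : V →ₗ[ℝ] V →ₗ[ℝ] V →ₗ[ℝ] V →ₗ[ℝ] ℝ)
    (hR1 : ∀ X Y Z W : V, R X Y Z W = - R Y X Z W)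
    (hR2 : ∀ X Y Z W : V, R X Y Z W = - R X Y W Z)
    (hR3 : ∀ X Y Z W : V, R X Y Z W = R Z W X Y)
    (hBianchi : ∀ X Y Z W : V, R X Y Z W + R Y Z X W + R Z X Y W = 0)
    (ν : ℝ)
    (hcasc : ∀ X Y : V, ⟪X, X⟫ = 1 → ⟪Y, Y⟫ = 1 → ⟪X, Y⟫ = 0 → ⟪X, J Y⟫ = 0 →
        R X Y X Y = ν) :
    ∀ X Y : V,
      (rhoStar b J (fun a b' c d => R a b' c d + R (J a) (J b') (J c) (J d)) X Y =
          rhoStar b J (fun a b' c d => R a b' c d) X Y +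
            rhoStar b J (fun a b' c d => R a b' c d) Y X) ∧
      (rhoStar b J (fun a b' c d => R a b' c d + R (J a) (J b') (J c) (J d)) (J X) (J Y) =
          rhoStar b J (fun a b' c d => R a b' c d + R (J a) (J b') (J c) (J d)) X Y) := by
  intro X Y
  have hskew : ∀ X Y : V, ⟪X, J Y⟫ = -⟪Y, J X⟫ := by
    intro X Y
    rw [← hJiso X (J Y), hJ2, inner_neg_right, real_inner_comm]
  constructor
  · unfold rhoStar
    rw [← Finset.sum_add_distrib]
    refine Finset.sum_congr rfl fun i _ => ?_
    simp only [hJ2, map_neg, LinearMap.neg_apply, neg_neg]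
    rw [hR3 (J (b i)) (J X)]
  · have key : ∀ A B : V, ∑ i, R (J (b i)) A (b i) B = - ∑ i, R (b i) A (J (b i)) B := by
      intro A B
      exact sum_J_swap b J hskew (LinearMap.mk₂ ℝ (fun u v => R u A v B)
        (by intros; simp) (by intros; simp) (by intros; simp) (by intros; simp))
    have k1 := key (J X) Y
    have k2 := key X (J Y)
    unfold rhoStar
    simp only [hJ2, map_neg, LinearMap.neg_apply, neg_neg, Finset.sum_add_distrib,
      Finset.sum_neg_distrib]
    linarith
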